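/- Let B : ℝ → ℝ³ be a continuously differentiable curve with B(s) ≠ 0, η(B(s),B(s)) = 0, and B(s) × B′(s) = 0 for all s ∈ ℝ. Then there exists a differentiable function h : ℝ → ℝ with h(s) > 0 for all s and h(0) = 1 such that B(s) = h(s)·B(0) for all s ∈ ℝ; in particular the image of B lies on a single ray through the origin. -/

import Mathlib

/-- The Minkowski bilinear form on `ℝ³`. -/
def eta (x y : Fin 3 → ℝ) : ℝ := -(x 0 * y 0) + x 1 * y 1 + x 2 * y 2

/-- The Lorentzian cross product on `ℝ³`. -/
def lcross (x y : Fin 3 → ℝ) : Fin 3 → ℝ :=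
  ![-(x 1 * y 2 - x 2 * y 1), x 2 * y 0 - x 0 * y 2, x 0 * y 1 - x 1 * y 0]

/-- A `C¹` null curve with `B × B′ = 0` lies on a single ray through the origin:
`B(s) = h(s) B(0)` for some positive differentiable function `h` with `h(0) = 1`. -/
theorem nullCurve_beta_zero_ray (B : ℝ → Fin 3 → ℝ) (hB : ContDiff ℝ 1 B)
    (hBne : ∀ s, B s ≠ 0) (hBnull : ∀ s, eta (B s) (B s) = 0)
    (hcross : ∀ s, lcross (B s) (deriv B s) = 0) :
    ∃ h : ℝ → ℝ, Differentiable ℝ h ∧ (∀ s, 0 < h s) ∧ h 0 = 1 ∧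
      ∀ s, B s = h s • B 0 := by
  have hd : Differentiable ℝ B := hB.differentiable (by norm_num)
  have hdi : ∀ i s, HasDerivAt (fun s => B s i) (deriv B s i) s := fun i s =>
    (hasDerivAt_pi.1 (hd s).hasDerivAt) i
  have h0 : ∀ s, B s 0 ≠ 0 := by
    intro s h
    have hn := hBnull s
    simp only [eta, h] at hn
    have h1 : B s 1 = 0 := by nlinarith [sq_nonneg (B s 1), sq_nonneg (B s 2)]
    have h2 : B s 2 = 0 := by nlinarith [sq_nonneg (B s 1), sq_nonneg (B s 2)]
    apply hBne s
    funext i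
    fin_cases i <;> simp [h, h1, h2]
  have hw : ∀ i s, deriv B s i * B s 0 - B s i * deriv B s 0 = 0 := by
    intro i s
    have c1 := congrFun (hcross s) 1
    have c2 := congrFun (hcross s) 2
    simp [lcross] at c1 c2
    fin_cases i
    · simp; ring
    · simp; linarith
    · simp; linarith
  have hconst : ∀ i s, B s i / B s 0 = B 0 i / B 0 0 := by
    intro i s
    have hder : ∀ t, HasDerivAt (fun s => B s i / B s 0) 0 t := by
      intro t
      have := (hdi i t).fun_div (hdi 0 t) (h0 t)
      rwa [hw i t, zero_div] at this
    exact is_const_of_deriv_eq_zero (fun t => (hder t).differentiableAt)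
      (fun t => (hder t).deriv) s 0
  have hdiff : Differentiable ℝ (fun s => B s 0 / B 0 0) := fun s =>
    ((hdi 0 s).div_const _).differentiableAt
  refine ⟨fun s => B s 0 / B 0 0, hdiff, ?_, div_self (h0 0), ?_⟩
  · intro s
    by_contra hneg
    have hmem : (0 : ℝ) ∈ Set.range (fun s => B s 0 / B 0 0) :=
      mem_range_of_exists_le_of_exists_ge hdiff.continuous ⟨s, not_lt.1 hneg⟩
        ⟨0, by simp [div_self (h0 0)]⟩
    obtain ⟨t, ht⟩ := hmem
    exact div_ne_zero (h0 t) (h0 0) ht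
  · intro s
    funext i
    have := hconst i s
    have a := h0 s
    have b := h0 0
    simp only [Pi.smul_apply, smul_eq_mul]
    rw [div_eq_div_iff a b] at this
    field_simp
    linarith
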